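/- For any convex set C ⊆ ℝ, a convex function f : C → [−∞,∞] is sequentially infimum-stable if and only if it is topologically infimum-stable, i.e., the map g ↦ inf_C g from the space of convex functions C → [−∞,∞] (with the topology of pointwise convergence) to [−∞,∞] is continuous at f. -/

import Mathlib

/-- A function `g : C → [−∞,∞]` (for `C ⊆ ℝ` convex) is convex if its
epigraph is a convex subset of `ℝ × ℝ`. -/
def IsConvexEFun (C : Set ℝ) (g : ↥C → EReal) : Prop :=
  Convex ℝ {p : ℝ × ℝ | ∃ hx : p.1 ∈ C, g ⟨p.1, hx⟩ ≤ (p.2 : EReal)}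

open Filter Topology Set

/-- Two-point convexity inequality for a function with convex epigraph. -/
lemma IsConvexEFun.le_combo {C : Set ℝ} {g : ↥C → EReal} (hg : IsConvexEFun C g)
    {x y z : ↥C} {s t u v : ℝ} (hs : 0 ≤ s) (ht : 0 ≤ t) (hst : s + t = 1)
    (hz : (z : ℝ) = s * x + t * y) (hx : g x ≤ (u : EReal)) (hy : g y ≤ (v : EReal)) :
    g z ≤ ((s * u + t * v : ℝ) : EReal) := by
  obtain ⟨h, hle⟩ := hg (x := ((x : ℝ), u)) (y := ((y : ℝ), v)) ⟨x.2, hx⟩ ⟨y.2, hy⟩ hs ht hst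
  have hzx : z = ⟨_, h⟩ := Subtype.ext (by simpa using hz)
  rw [hzx]
  simpa using hle

/-- If `y` lies strictly between `p` and `x`, a lower bound at `y` and an upper bound at `p`
give a lower bound at `x`, eventually along a filter. -/
lemma eventually_lt_of_combo {C : Set ℝ} {ι : Type*} {l : Filter ι} {G : ι → ↥C → EReal}
    (hG : ∀ i, IsConvexEFun C (G i)) {p x y : ↥C} {s t u a : ℝ}
    (hs : 0 ≤ s) (ht : 0 ≤ t) (hst : s + t = 1) (hy : (y : ℝ) = s * p + t * x)
    (hpu : ∀ᶠ i in l, G i p < (u : EReal))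
    (hya : ∀ᶠ i in l, ((s * u + t * a : ℝ) : EReal) < G i y) :
    ∀ᶠ i in l, (a : EReal) < G i x := by
  filter_upwards [hpu, hya] with i h1 h2
  by_contra! h3
  exact absurd ((hG i).le_combo hs ht hst hy h1.le h3) (not_le.2 h2)

/-- Real weights expressing a point of a segment as a convex combination. -/
lemma exists_weights_of_mem_uIcc {p x y : ℝ} (h : y ∈ uIcc p x) :
    ∃ s t : ℝ, 0 ≤ s ∧ 0 ≤ t ∧ s + t = 1 ∧ y = s * p + t * x := by
  rw [← segment_eq_uIcc] at h
  obtain ⟨s, t, hs, ht, hst, rfl⟩ := h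
  exact ⟨s, t, hs, ht, hst, rfl⟩

/-- The effective domain of an extended-real-valued function, as a subset of `ℝ`. -/
def effDomain {C : Set ℝ} (f : ↥C → EReal) : Set ℝ :=
  {x | ∃ h : x ∈ C, f ⟨x, h⟩ < ⊤}

lemma effDomain_convex {C : Set ℝ} {f : ↥C → EReal} (hf : IsConvexEFun C f) (hC : Convex ℝ C) :
    Convex ℝ (effDomain f) := by
  rintro x ⟨hx, hfx⟩ y ⟨hy, hfy⟩ s t hs ht hst
  obtain ⟨u, hu, -⟩ := EReal.lt_iff_exists_real_btwn.1 hfx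
  obtain ⟨v, hv, -⟩ := EReal.lt_iff_exists_real_btwn.1 hfy
  exact ⟨hC hx hy hs ht hst,
    (hf.le_combo hs ht hst rfl hu.le hv.le).trans_lt (EReal.coe_lt_top _)⟩

/-- A convex function that never takes the value `-∞` is continuous on the interior of its
effective domain. -/
lemma exists_continuousOn_interior_effDomain {C : Set ℝ} {f : ↥C → EReal}
    (hf : IsConvexEFun C f) (hC : Convex ℝ C) (hbot : ∀ x, f x ≠ ⊥) :
    ∃ φ : ℝ → ℝ, (∀ x : ↥C, (x : ℝ) ∈ effDomain f → f x = (φ x : EReal)) ∧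
      ContinuousOn φ (interior (effDomain f)) := by
  classical
  let φ : ℝ → ℝ := fun x => if h : x ∈ C then (f ⟨x, h⟩).toReal else 0
  have hφ : ∀ x : ↥C, (x : ℝ) ∈ effDomain f → f x = (φ x : EReal) := by
    rintro x ⟨h, hlt⟩
    have : φ x = (f x).toReal := by simp [φ]
    rw [this, EReal.coe_toReal hlt.ne (hbot x)]
  refine ⟨φ, hφ, ConvexOn.continuousOn_interior ⟨effDomain_convex hf hC, ?_⟩⟩
  intro x hx y hy s t hs ht hst
  have hz := effDomain_convex hf hC hx hy hs ht hst
  have := hf.le_combo (x := ⟨x, hx.1⟩) (y := ⟨y, hy.1⟩) (z := ⟨_, hz.1⟩) hs ht hst rfl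
    (hφ ⟨x, hx.1⟩ hx).le (hφ ⟨y, hy.1⟩ hy).le
  rw [hφ ⟨_, hz.1⟩ hz] at this
  exact_mod_cast this

/-- A property holding near `x` holds at rational points on both sides of `x`. -/
lemma exists_rat_lt_of_eventually {x : ℝ} {P : ℝ → Prop} (h : ∀ᶠ y in 𝓝 x, P y) :
    (∃ q : ℚ, (q : ℝ) < x ∧ P q) ∧ ∃ q : ℚ, x < (q : ℝ) ∧ P q := by
  obtain ⟨a, b, ⟨ha, hb⟩, hab⟩ := mem_nhds_iff_exists_Ioo_subset.1 h
  obtain ⟨q, hq1, hq2⟩ := exists_rat_btwn ha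
  obtain ⟨r, hr1, hr2⟩ := exists_rat_btwn hb
  exact ⟨⟨q, hq2, hab ⟨hq1, hq2.trans hb⟩⟩, ⟨r, hr1, hab ⟨ha.trans hr1, hr2⟩⟩⟩

/-- At an interior point of the effective domain of the limit, convergence of convex functions
at rational points implies convergence. -/
lemma tendsto_of_mem_interior_effDomain {C : Set ℝ} {f : ↥C → EReal} (hf : IsConvexEFun C f)
    (hC : Convex ℝ C) (hbot : ∀ x, f x ≠ ⊥) {ι : Type*} {l : Filter ι} {G : ι → ↥C → EReal}
    (hG : ∀ i, IsConvexEFun C (G i))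
    (hlim : ∀ x : ↥C, (x : ℝ) ∈ range ((↑) : ℚ → ℝ) → Tendsto (fun i => G i x) l (𝓝 (f x)))
    {x : ↥C} (hx : (x : ℝ) ∈ interior (effDomain f)) :
    Tendsto (fun i => G i x) l (𝓝 (f x)) := by
  obtain ⟨φ, hφ, hcont⟩ := exists_continuousOn_interior_effDomain hf hC hbot
  have hcx : ContinuousAt φ x := hcont.continuousAt (isOpen_interior.mem_nhds hx)
  have hI : ∀ᶠ y in 𝓝 (x : ℝ), y ∈ effDomain f := mem_interior_iff_mem_nhds.1 hx
  have hfx := hφ x (interior_subset hx)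
  refine tendsto_order.2 ⟨fun a ha => ?_, fun b hb => ?_⟩
  · obtain ⟨a', haa', ha'⟩ := EReal.lt_iff_exists_real_btwn.1 ha
    rw [hfx, EReal.coe_lt_coe_iff] at ha'
    obtain ⟨c, hac, hc⟩ := exists_between ha'
    obtain ⟨⟨p, hpx, hp⟩, -⟩ := exists_rat_lt_of_eventually hI
    have hpos : 0 < (x : ℝ) - p := sub_pos.2 hpx
    set u : ℝ := φ p + 1 with hu
    have hchord : ∀ᶠ y in 𝓝 (x : ℝ),
        ((x : ℝ) - y) / (x - p) * u + (y - p) / (x - p) * a' < c := by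
      have : ContinuousAt (fun y : ℝ => ((x : ℝ) - y) / (x - p) * u + (y - p) / (x - p) * a') x := by
        fun_prop
      refine this.eventually_lt continuousAt_const ?_
      simpa [hpos.ne'] using hac
    obtain ⟨⟨y, hyx, hyI, hyp, hyc, hyφ⟩, -⟩ := exists_rat_lt_of_eventually
      (hI.and ((eventually_gt_nhds hpx).and (hchord.and (hcx.eventually_const_lt hc))))
    have key := eventually_lt_of_combo (l := l) hG (p := ⟨p, hp.1⟩) (x := x) (y := ⟨y, hyI.1⟩)
      (s := (x - y) / (x - p)) (t := (y - p) / (x - p)) (u := u) (a := a')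
      (div_nonneg (sub_nonneg.2 hyx.le) hpos.le) (div_nonneg (sub_nonneg.2 hyp.le) hpos.le)
      (by field_simp; ring) (by simp only; field_simp; ring)
      ((hlim ⟨p, hp.1⟩ ⟨p, rfl⟩).eventually_lt_const (by
        rw [hφ ⟨p, hp.1⟩ hp, EReal.coe_lt_coe_iff, hu]; exact lt_add_one _))
      ((hlim ⟨y, hyI.1⟩ ⟨y, rfl⟩).eventually_const_lt (by
        rw [hφ ⟨y, hyI.1⟩ hyI, EReal.coe_lt_coe_iff]; exact hyc.trans hyφ))
    exact key.mono fun i hi => haa'.trans hi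
  · obtain ⟨b', hb', hbb'⟩ := EReal.lt_iff_exists_real_btwn.1 hb
    rw [hfx, EReal.coe_lt_coe_iff] at hb'
    obtain ⟨⟨y, hyx, hyI, hyφ⟩, ⟨z, hxz, hzI, hzφ⟩⟩ :=
      exists_rat_lt_of_eventually (hI.and (hcx.eventually_lt_const hb'))
    obtain ⟨s, t, hs, ht, hst, hxst⟩ :=
      exists_weights_of_mem_uIcc (mem_uIcc_of_le hyx.le hxz.le)
    filter_upwards [(hlim ⟨y, hyI.1⟩ ⟨y, rfl⟩).eventually_lt_const (u := (b' : EReal)) (by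
        rw [hφ ⟨y, hyI.1⟩ hyI, EReal.coe_lt_coe_iff]; exact hyφ),
      (hlim ⟨z, hzI.1⟩ ⟨z, rfl⟩).eventually_lt_const (u := (b' : EReal)) (by
        rw [hφ ⟨z, hzI.1⟩ hzI, EReal.coe_lt_coe_iff]; exact hzφ)] with i h1 h2
    refine ((hG i).le_combo hs ht hst hxst h1.le h2.le).trans_lt ?_
    rwa [← add_mul, hst, one_mul]

/-- If `p` is in the effective domain of the limit, and `y` is a point between `p` and `x` where
the limit is `+∞`, then convergence at `p` and `y` implies divergence to `+∞` at `x`. -/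
lemma tendsto_top_of_mem_uIcc {C : Set ℝ} {f : ↥C → EReal} {ι : Type*} {l : Filter ι}
    {G : ι → ↥C → EReal} (hG : ∀ i, IsConvexEFun C (G i)) {p x y : ↥C}
    (hp : f p < ⊤) (hy : f y = ⊤) (hmem : (y : ℝ) ∈ uIcc (p : ℝ) x)
    (hlp : Tendsto (fun i => G i p) l (𝓝 (f p))) (hly : Tendsto (fun i => G i y) l (𝓝 (f y))) :
    Tendsto (fun i => G i x) l (𝓝 ⊤) := by
  obtain ⟨s, t, hs, ht, hst, hyst⟩ := exists_weights_of_mem_uIcc hmem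
  obtain ⟨u, hu, -⟩ := EReal.lt_iff_exists_real_btwn.1 hp
  refine EReal.tendsto_nhds_top_iff_real.2 fun a => ?_
  exact eventually_lt_of_combo hG hs ht hst hyst (hlp.eventually_lt_const hu)
    (hly.eventually_const_lt (hy ▸ EReal.coe_lt_top _))

/-- A countable set of points detects pointwise convergence of convex functions to a convex
function with values in `(-∞,∞]` that is not identically `+∞`. -/
lemma exists_countable_tendsto {C : Set ℝ} {f : ↥C → EReal} (hf : IsConvexEFun C f)
    (hC : Convex ℝ C) (hbot : ∀ x, f x ≠ ⊥) (htop : ∃ x, f x ≠ ⊤) :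
    ∃ D : Set ↥C, D.Countable ∧ ∀ {ι : Type} (l : Filter ι) (G : ι → ↥C → EReal),
      (∀ i, IsConvexEFun C (G i)) → (∀ x ∈ D, Tendsto (fun i => G i x) l (𝓝 (f x))) →
      ∀ x, Tendsto (fun i => G i x) l (𝓝 (f x)) := by
  obtain ⟨p, hp⟩ := htop
  set I := effDomain f
  have hpI : (p : ℝ) ∈ I := ⟨p.2, hp.lt_top⟩
  have hIc : OrdConnected I := (effDomain_convex hf hC).ordConnected
  have hCc : OrdConnected C := hC.ordConnected
  let E : Set ℝ := range ((↑) : ℚ → ℝ) ∪ {sInf I, sSup I, (p : ℝ)}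
  have hE : E.Countable := (countable_range _).union (Set.toFinite _).countable
  refine ⟨Subtype.val ⁻¹' E, hE.preimage Subtype.val_injective, ?_⟩
  intro ι l G hG hlim x
  by_cases hxE : (x : ℝ) ∈ E
  · exact hlim x hxE
  have hpx : (p : ℝ) ≠ x := fun h => hxE (Or.inr (by simp [h]))
  by_cases hxI : (x : ℝ) ∈ I
  · have hlt : ∃ y ∈ I, y < (x : ℝ) := by
      by_contra! h
      exact hxE (Or.inr (Or.inl (IsLeast.csInf_eq ⟨hxI, h⟩).symm))
    have hgt : ∃ y ∈ I, (x : ℝ) < y := by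
      by_contra! h
      exact hxE (Or.inr (Or.inr (Or.inl (IsGreatest.csSup_eq ⟨hxI, h⟩).symm)))
    obtain ⟨y, hy, hyx⟩ := hlt
    obtain ⟨z, hz, hxz⟩ := hgt
    refine tendsto_of_mem_interior_effDomain hf hC hbot hG
      (fun q hq => hlim q (Or.inl hq)) ?_
    exact mem_interior_iff_mem_nhds.2
      (mem_of_superset (Icc_mem_nhds hyx hxz) (hIc.out hy hz))
  · have hfx : f x = ⊤ := by
      by_contra h
      exact hxI ⟨x.2, lt_top_iff_ne_top.2 h⟩
    have hbetween : ∃ q : ℚ, (q : ℝ) ∈ uIcc (p : ℝ) x ∧ (q : ℝ) ∉ I := by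
      rcases hpx.lt_or_gt with h | h
      · have hub : ∀ z ∈ I, z ≤ (x : ℝ) := fun z hz => by
          by_contra! hxz
          exact hxI (hIc.out hpI hz ⟨h.le, hxz.le⟩)
        have hsx : sSup I < x := lt_of_le_of_ne (csSup_le ⟨_, hpI⟩ hub)
          fun h => hxE (Or.inr (by simp [h]))
        obtain ⟨q, hq1, hq2⟩ := exists_rat_btwn hsx
        have hle : ∀ z ∈ I, z ≤ sSup I := fun z hz => le_csSup ⟨x, hub⟩ hz
        exact ⟨q, mem_uIcc_of_le ((hle p hpI).trans hq1.le) hq2.le,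
          fun hq => (hle q hq).not_gt hq1⟩
      · have hlb : ∀ z ∈ I, (x : ℝ) ≤ z := fun z hz => by
          by_contra! hxz
          exact hxI (hIc.out hz hpI ⟨hxz.le, h.le⟩)
        have hsx : (x : ℝ) < sInf I := lt_of_le_of_ne (le_csInf ⟨_, hpI⟩ hlb)
          fun h => hxE (Or.inr (by simp [h]))
        obtain ⟨q, hq1, hq2⟩ := exists_rat_btwn hsx
        have hle : ∀ z ∈ I, sInf I ≤ z := fun z hz => csInf_le ⟨x, hlb⟩ hz
        exact ⟨q, mem_uIcc_of_ge hq1.le (hq2.le.trans (hle p hpI)),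
          fun hq => (hle q hq).not_gt hq2⟩
    obtain ⟨q, hq, hqI⟩ := hbetween
    have hqC : (q : ℝ) ∈ C := hCc.uIcc_subset p.2 x.2 hq
    have hfq : f ⟨q, hqC⟩ = ⊤ := by
      by_contra h
      exact hqI ⟨hqC, lt_top_iff_ne_top.2 h⟩
    rw [hfx]
    exact tendsto_top_of_mem_uIcc hG hp.lt_top hfq hq (hlim p (Or.inr (by simp)))
      (hlim _ (Or.inl ⟨q, rfl⟩))

/-- The function that vanishes at one point and is `+∞` elsewhere is convex. -/
lemma isConvexEFun_indicator_singleton {C : Set ℝ} [DecidableEq ↥C] (p : ↥C) :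
    IsConvexEFun C (fun x => if x = p then 0 else ⊤) := by
  have hmem : ∀ q : ℝ × ℝ,
      (∃ h : q.1 ∈ C, (if (⟨q.1, h⟩ : ↥C) = p then (0 : EReal) else ⊤) ≤ (q.2 : EReal)) ↔
        q ∈ ({(p : ℝ)} : Set ℝ) ×ˢ Ici (0 : ℝ) := by
    rintro ⟨a, b⟩
    constructor
    · rintro ⟨h, hle⟩
      split_ifs at hle with hap
      · exact ⟨congrArg Subtype.val hap, by exact_mod_cast hle⟩
      · exact absurd hle (not_le.2 (EReal.coe_lt_top _))
    · rintro ⟨rfl, hb⟩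
      exact ⟨p.2, by simpa using hb⟩
  have : {q : ℝ × ℝ | ∃ h : q.1 ∈ C,
      (if (⟨q.1, h⟩ : ↥C) = p then (0 : EReal) else ⊤) ≤ (q.2 : EReal)} =
        ({(p : ℝ)} : Set ℝ) ×ˢ Ici (0 : ℝ) := Set.ext hmem
  unfold IsConvexEFun
  rw [this]
  exact (convex_singleton _).prod (convex_Ici _)

/-- On an infinite set, some sequence of convex functions with nonpositive infimum converges
pointwise to `+∞`. -/
lemma exists_seq_tendsto_top {C : Set ℝ} [Infinite ↥C] :
    ∃ F : ℕ → {g : ↥C → EReal // IsConvexEFun C g},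
      (∀ x, Tendsto (fun n => (F n).1 x) atTop (𝓝 ⊤)) ∧ ∀ n, ⨅ x, (F n).1 x ≤ 0 := by
  classical
  let e := Infinite.natEmbedding ↥C
  refine ⟨fun n => ⟨_, isConvexEFun_indicator_singleton (e n)⟩, fun x => ?_,
    fun n => (iInf_le _ (e n)).trans (by simp)⟩
  refine tendsto_const_nhds.congr' ?_
  have hsub : {n | x = e n}.Subsingleton := fun m hm n hn => e.injective (hm.symm.trans hn)
  filter_upwards [hsub.finite.eventually_cofinite_notMem.filter_mono Nat.cofinite_eq_atTop.ge]
    with n hn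
  exact (if_neg hn).symm

/-- Sequential continuity of the infimum implies continuity when convergence of convex functions
to `f` is detected by countably many points. -/
lemma continuousAt_iInf_of_countable {C : Set ℝ} {f : {g : ↥C → EReal // IsConvexEFun C g}}
    {D : Set ↥C} (hD : D.Countable)
    (hdet : ∀ F : ℕ → {g : ↥C → EReal // IsConvexEFun C g},
      (∀ x ∈ D, Tendsto (fun n => (F n).1 x) atTop (𝓝 (f.1 x))) →
      ∀ x, Tendsto (fun n => (F n).1 x) atTop (𝓝 (f.1 x)))
    (hseq : ∀ F : ℕ → {g : ↥C → EReal // IsConvexEFun C g},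
      (∀ x, Tendsto (fun n => (F n).1 x) atTop (𝓝 (f.1 x))) →
      Tendsto (fun n => ⨅ x, (F n).1 x) atTop (𝓝 (⨅ x, f.1 x))) :
    ContinuousAt (fun g : {g : ↥C → EReal // IsConvexEFun C g} => ⨅ x, g.1 x) f := by
  have := hD.to_subtype
  let l : Filter {g : ↥C → EReal // IsConvexEFun C g} :=
    ⨅ x : D, comap (fun g => g.1 x) (𝓝 (f.1 x))
  have hle : 𝓝 f ≤ l := le_iInf fun x =>
    ((continuous_apply (x : ↥C)).comp continuous_subtype_val).continuousAt.le_comap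
  refine Tendsto.mono_left (tendsto_of_seq_tendsto fun F hF => ?_) hle
  refine hseq F (hdet F fun x hx => ?_)
  exact tendsto_comap_iff.1 (tendsto_iInf.1 hF ⟨x, hx⟩)

/-- For any convex `C ⊆ ℝ`, a convex `f : C → [−∞,∞]` is sequentially
infimum-stable iff it is topologically infimum-stable, i.e. `g ↦ inf_C g`
is continuous at `f` on the space of convex functions with the topology of
pointwise convergence. -/
theorem stmt_18 (C : Set ℝ) (hC : Convex ℝ C)
    (f : {g : ↥C → EReal // IsConvexEFun C g}) :
    (∀ F : ℕ → {g : ↥C → EReal // IsConvexEFun C g},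
        (∀ x : ↥C, Filter.Tendsto (fun n => (F n).1 x) Filter.atTop (nhds (f.1 x))) →
        Filter.Tendsto (fun n => ⨅ x, (F n).1 x) Filter.atTop (nhds (⨅ x, f.1 x)))
      ↔
    ContinuousAt (fun g : {g : ↥C → EReal // IsConvexEFun C g} => ⨅ x, g.1 x) f := by
  constructor
  · intro hseq
    by_cases hbot : ∃ x, f.1 x = ⊥
    · obtain ⟨x, hx⟩ := hbot
      have hinf : ⨅ x, f.1 x = ⊥ := le_bot_iff.1 (hx ▸ iInf_le _ x)
      refine tendsto_order.2 ⟨fun a ha => absurd ha (by simp [hinf]), fun b hb => ?_⟩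
      have hev : Tendsto (fun g : {g : ↥C → EReal // IsConvexEFun C g} => g.1 x) (𝓝 f)
          (𝓝 (f.1 x)) := ((continuous_apply x).comp continuous_subtype_val).continuousAt
      filter_upwards [hev.eventually_lt_const (show f.1 x < b by rwa [hx, ← hinf])] with g hg
      exact (iInf_le _ x).trans_lt hg
    push Not at hbot
    by_cases hcount : Countable ↥C
    · exact continuousAt_iInf_of_countable (countable_univ (α := ↥C))
        (fun F hF x => hF x (mem_univ x)) hseq
    by_cases htop : ∃ x, f.1 x ≠ ⊤
    · obtain ⟨D, hD, hdet⟩ := exists_countable_tendsto f.2 hC hbot htop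
      exact continuousAt_iInf_of_countable hD
        (fun F hF => hdet atTop (fun n => (F n).1) (fun n => (F n).2) hF) hseq
    · push Not at htop
      have : Infinite ↥C := by
        by_contra h
        rw [not_infinite_iff_finite] at h
        exact hcount inferInstance
      obtain ⟨F, hF, hF0⟩ := exists_seq_tendsto_top (C := C)
      have hlim := hseq F fun x => by rw [htop x]; exact hF x
      have h0 : ⨅ x, f.1 x ≤ 0 := le_of_tendsto' hlim hF0
      simp [htop] at h0
  · intro hcont F hF
    have hFf : Tendsto F atTop (𝓝 f) := tendsto_subtype_rng.2 (tendsto_pi_nhds.2 hF)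
    exact hcont.tendsto.comp hFf
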